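/- For every nondegenerate triangle K in ℝ², the following 21 matrix fields form a basis of Σ(K): for each vertex index i ∈ {0,1,2}, the three fields λ_i² E₁₁, λ_i² E₂₂, λ_i² (E₁₂ + E₂₁), where E_{ℓm} are the standard 2×2 matrix units; for each cyclic permutation (i,j,k) of (0,1,2), the fields φ_{i,1} := 36 λ_j λ_k n_i⊗n_i − 6ψ_i and φ_{i,2} := −24 λ_j λ_k n_i⊗n_i + 6ψ_i; for each cyclic permutation (i,j,k), the field λ_j λ_k sym(t_i⊗n_i); and for each cyclic permutation (i,j,k), the field λ_j λ_k t_i⊗t_i. -/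

import Mathlib

open MeasureTheory Matrix

noncomputable section

/-- Points of the plane ℝ². -/
abbrev V2 := Fin 2 → ℝ

/-- 2×2 real matrices. -/
abbrev Mat2 := Matrix (Fin 2) (Fin 2) ℝ

/-- The Euclidean dot product on ℝ². -/
def dot2 (x y : V2) : ℝ := x 0 * y 0 + x 1 * y 1

/-- The Euclidean norm on ℝ². -/
def norm2 (x : V2) : ℝ := Real.sqrt (dot2 x x)

/-- Rotation by -90 degrees, used to produce a unit normal from a unit tangent. -/
def rot (x : V2) : V2 := ![x 1, -(x 0)]

/-- The closed triangle with vertices `v 0, v 1, v 2`. -/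
def tri (v : Fin 3 → V2) : Set V2 := convexHull ℝ (Set.range v)

/-- `f` is (the function of) a real polynomial in two variables of total degree at most `k`. -/
def PolyDeg (k : ℕ) (f : V2 → ℝ) : Prop :=
  ∃ p : MvPolynomial (Fin 2) ℝ, p.totalDegree ≤ k ∧ ∀ x : V2, f x = MvPolynomial.eval x p

/-- matrix-valued polynomial fields of degree at most `k`, i.e. ℙ_k(·;𝕄). -/
def IsPolyMat (k : ℕ) (τ : V2 → Mat2) : Prop := ∀ i j, PolyDeg k fun x => τ x i j

/-- vector-valued polynomial fields of degree at most `k`, i.e. ℙ_k(·;ℝ²). -/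
def IsPolyVec (k : ℕ) (f : V2 → V2) : Prop := ∀ i, PolyDeg k fun x => f x i

/-- `f` agrees on `[0,1]` with a univariate polynomial of degree at most `k`
(used for restrictions to an edge, in an affine parametrization of the edge). -/
def IsPoly1 (k : ℕ) (f : ℝ → ℝ) : Prop :=
  ∃ p : Polynomial ℝ, p.natDegree ≤ k ∧ ∀ s ∈ Set.Icc (0:ℝ) 1, f s = Polynomial.eval s p

/-- Partial derivative in the `a`-th coordinate direction. -/
def pd (f : V2 → ℝ) (a : Fin 2) : V2 → ℝ := fun x => fderiv ℝ f x (Pi.single a 1)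

/-- Directional derivative of `f` in direction `w`. -/
def dirD (f : V2 → ℝ) (w : V2) (x : V2) : ℝ := fderiv ℝ f x w

/-- Row-wise divergence of a matrix-valued field. -/
def divMat (τ : V2 → Mat2) : V2 → V2 := fun x i => ∑ j, pd (fun y => τ y i j) j x

/-- The edge `e i` of the triangle, opposite to the vertex `v i`. -/
def edgeSet (v : Fin 3 → V2) (i : Fin 3) : Set V2 := segment ℝ (v (i+1)) (v (i+2))

/-- Affine parametrization of the edge `e i` over `[0,1]`. -/
def edgePt (v : Fin 3 → V2) (i : Fin 3) (s : ℝ) : V2 := v (i+1) + s • (v (i+2) - v (i+1))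

/-- The length of the edge `e i`. -/
def elen (v : Fin 3 → V2) (i : Fin 3) : ℝ := norm2 (v (i+2) - v (i+1))

/-- The unit tangent vector of the edge `e i`. -/
def tang (v : Fin 3 → V2) (i : Fin 3) : V2 := (elen v i)⁻¹ • (v (i+2) - v (i+1))

/-- The unit normal vector of the edge `e i`. -/
def nrml (v : Fin 3 → V2) (i : Fin 3) : V2 := rot (tang v i)

/-- The arclength integral over the edge `e i`. -/
def edgeInt (v : Fin 3 → V2) (i : Fin 3) (f : V2 → ℝ) : ℝ :=
  ∫ s in (0:ℝ)..1, f (edgePt v i s) * elen v i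

/-- The symmetric part of a matrix. -/
def symm2 (A : Mat2) : Mat2 := (2:ℝ)⁻¹ • (A + Aᵀ)

/-- The shape function space Σ(K) = {τ ∈ ℙ₃(K;𝕊) : div τ ∈ ℙ₁(K;ℝ²),
tᵀτn|ₑ ∈ ℙ₂(e) for each edge e}. -/
def SigmaSet (v : Fin 3 → V2) : Set (V2 → Mat2) :=
  {τ | IsPolyMat 3 τ ∧ (∀ x, (τ x).IsSymm) ∧ IsPolyVec 1 (divMat τ) ∧
    ∀ i : Fin 3, IsPoly1 2 fun s => dot2 (tang v i) ((τ (edgePt v i s)).mulVec (nrml v i))}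

/-- c_{ab} = ∇λ_a · ∇λ_b, where `g a` is the (constant) gradient of λ_a. -/
def cc (g : Fin 3 → V2) (a b : Fin 3) : ℝ := dot2 (g a) (g b)

/-- t_{ab} := v_b − v_a. -/
def tv (v : Fin 3 → V2) (a b : Fin 3) : V2 := v b - v a

/-- Outer product u ⊗ u. -/
def ot (u : V2) : Mat2 := Matrix.vecMulVec u u

/-- The matrix field ψ_i of Lemma 2.3, for the cyclic permutation (i, i+1, i+2). -/
def psi (v : Fin 3 → V2) (lam : Fin 3 → V2 → ℝ) (g : Fin 3 → V2) (i : Fin 3) :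
    V2 → Mat2 := fun x =>
  (-10 * cc g i (i+2) * lam (i+1) x * lam (i+2) x ^ 2) • ot (tv v (i+2) i)
  + (-10 * cc g i (i+1) * (lam (i+2) x + lam i x) * lam (i+1) x * lam (i+2) x) • ot (tv v i (i+1))
  + (((6 * cc g i (i+1) - 9 * cc g i (i+2)) * lam (i+1) x
      + (9 * cc g i (i+1) - 6 * cc g i (i+2)) * lam (i+2) x)
      * lam (i+1) x * lam (i+2) x) • ot (tv v (i+1) (i+2))
  + (((6 * cc g i (i+1) - 9 * cc g i (i+2)) * lam (i+1) x
      + (2 * cc g i (i+2) - 3 * cc g i (i+1)) * lam (i+2) x)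
      * lam (i+2) x * lam i x) • ot (tv v (i+2) i)
  + (((3 * cc g i (i+2) - 2 * cc g i (i+1)) * lam (i+1) x
      + (9 * cc g i (i+1) - 6 * cc g i (i+2)) * lam (i+2) x)
      * lam i x * lam (i+1) x) • ot (tv v i (i+1))

/-- φ_{i,1} := 36 λ_j λ_k n_i ⊗ n_i − 6 ψ_i. -/
def phi1 (v : Fin 3 → V2) (lam : Fin 3 → V2 → ℝ) (g : Fin 3 → V2) (i : Fin 3) :
    V2 → Mat2 := fun x =>
  (36 * lam (i+1) x * lam (i+2) x) • ot (nrml v i) - (6:ℝ) • psi v lam g i x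

/-- φ_{i,2} := −24 λ_j λ_k n_i ⊗ n_i + 6 ψ_i. -/
def phi2 (v : Fin 3 → V2) (lam : Fin 3 → V2 → ℝ) (g : Fin 3 → V2) (i : Fin 3) :
    V2 → Mat2 := fun x =>
  (-24 * lam (i+1) x * lam (i+2) x) • ot (nrml v i) + (6:ℝ) • psi v lam g i x

/-- The 21 candidate basis fields of Σ(K), indexed by (i, m) ∈ Fin 3 × Fin 7:
for m = 0,1,2 the vertex fields λ_i²E₁₁, λ_i²E₂₂, λ_i²(E₁₂+E₂₁); for m = 3,4 the
fields φ_{i,1}, φ_{i,2}; for m = 5 the field λ_jλ_k sym(t_i⊗n_i); for m = 6 the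
field λ_jλ_k t_i⊗t_i  (with (i,j,k) = (i,i+1,i+2)). -/
def basis21 (v : Fin 3 → V2) (lam : Fin 3 → V2 → ℝ) (g : Fin 3 → V2) :
    Fin 3 × Fin 7 → (V2 → Mat2) := fun m =>
  ![fun x => lam m.1 x ^ 2 • (!![1,0;0,0] : Mat2),
    fun x => lam m.1 x ^ 2 • (!![0,0;0,1] : Mat2),
    fun x => lam m.1 x ^ 2 • (!![0,1;1,0] : Mat2),
    phi1 v lam g m.1,
    phi2 v lam g m.1,
    fun x => (lam (m.1+1) x * lam (m.1+2) x) • symm2 (Matrix.vecMulVec (tang v m.1) (nrml v m.1)),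
    fun x => (lam (m.1+1) x * lam (m.1+2) x) • ot (tang v m.1)] m.2


/-! ### Polynomial functions -/

theorem PolyDeg.const (k : ℕ) (c : ℝ) : PolyDeg k fun _ => c :=
  ⟨MvPolynomial.C c, by simp, by simp⟩

theorem PolyDeg.coord (a : Fin 2) : PolyDeg 1 fun x => x a :=
  ⟨MvPolynomial.X a, by simp, by simp⟩

theorem PolyDeg.mono {k l : ℕ} {f : V2 → ℝ} (h : PolyDeg k f) (hkl : k ≤ l) : PolyDeg l f :=
  let ⟨p, hp, hf⟩ := h
  ⟨p, hp.trans hkl, hf⟩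

theorem PolyDeg.add {k : ℕ} {f g : V2 → ℝ} (hf : PolyDeg k f) (hg : PolyDeg k g) :
    PolyDeg k fun x => f x + g x := by
  obtain ⟨p, hp, hf⟩ := hf
  obtain ⟨q, hq, hg⟩ := hg
  exact ⟨p + q, (MvPolynomial.totalDegree_add p q).trans (max_le hp hq),
    fun x => by simp [hf, hg]⟩

theorem PolyDeg.mul {k l : ℕ} {f g : V2 → ℝ} (hf : PolyDeg k f) (hg : PolyDeg l g) :
    PolyDeg (k + l) fun x => f x * g x := by
  obtain ⟨p, hp, hf⟩ := hf
  obtain ⟨q, hq, hg⟩ := hg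
  exact ⟨p * q, (MvPolynomial.totalDegree_mul p q).trans (add_le_add hp hq),
    fun x => by simp [hf, hg]⟩

theorem PolyDeg.const_mul {k : ℕ} {f : V2 → ℝ} (c : ℝ) (hf : PolyDeg k f) :
    PolyDeg k fun x => c * f x := by
  simpa using (PolyDeg.const 0 c).mul hf

theorem PolyDeg.induction {k : ℕ} {Q : (V2 → ℝ) → Prop} (zero : Q fun _ => 0)
    (add : ∀ f g, Q f → Q g → Q fun x => f x + g x)
    (monomial : ∀ (c : ℝ) (a b : ℕ), a + b ≤ k → Q fun x => c * (x 0 ^ a * x 1 ^ b))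
    {f : V2 → ℝ} (hf : PolyDeg k f) : Q f := by
  obtain ⟨p, hp, hf⟩ := hf
  have key : ∀ s : Finset (Fin 2 →₀ ℕ), s ⊆ p.support →
      Q fun x => ∑ d ∈ s, p.coeff d * (x 0 ^ d 0 * x 1 ^ d 1) := by
    intro s
    induction s using Finset.induction_on with
    | empty => intro _; simpa using zero
    | insert d s hd ih =>
      intro hs
      simp only [Finset.sum_insert hd]
      refine add _ _ (monomial _ _ _ ?_) (ih fun e he => hs (Finset.mem_insert_of_mem he))
      have h := (MvPolynomial.le_totalDegree (hs (Finset.mem_insert_self d s))).trans hp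
      rwa [Finsupp.sum_fintype _ _ fun _ => rfl, Fin.sum_univ_two] at h
  have hfp : f = fun x => ∑ d ∈ p.support, p.coeff d * (x 0 ^ d 0 * x 1 ^ d 1) := by
    funext x
    rw [hf, MvPolynomial.eval_eq']
    simp [Fin.prod_univ_two]
  rw [hfp]
  exact key _ subset_rfl

theorem PolyDeg.differentiable {k : ℕ} {f : V2 → ℝ} (hf : PolyDeg k f) : Differentiable ℝ f :=
  hf.induction (Q := fun f => Differentiable ℝ f) (by fun_prop)
    (fun _ _ h₁ h₂ => h₁.add h₂) (fun _ _ _ _ => by fun_prop)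

theorem PolyDeg.midpoint {f : V2 → ℝ} (hf : PolyDeg 1 f) (p q : V2) :
    2 * f ((2:ℝ)⁻¹ • (p + q)) = f p + f q := by
  refine hf.induction (Q := fun f => 2 * f ((2:ℝ)⁻¹ • (p + q)) = f p + f q) (by simp)
    (fun f g h₁ h₂ => by linear_combination h₁ + h₂) (fun c a b hab => ?_)
  have ha : a ≤ 1 := by lia
  have hb : b ≤ 1 := by lia
  interval_cases a <;> interval_cases b <;> first | lia | (simp; try ring)

/-- A cubic polynomial written in Bernstein form with respect to three points. -/
theorem PolyDeg.bernstein {f : V2 → ℝ} (hf : PolyDeg 3 f) (p q w : V2) :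
    ∃ b : Fin 10 → ℝ, ∀ r s t : ℝ, r + s + t = 1 → f (r • p + s • q + t • w) =
      b 0 * r ^ 3 + b 1 * s ^ 3 + b 2 * t ^ 3 + b 3 * r ^ 2 * s + b 4 * r * s ^ 2
        + b 5 * s ^ 2 * t + b 6 * s * t ^ 2 + b 7 * t ^ 2 * r + b 8 * t * r ^ 2
        + b 9 * r * s * t := by
  refine hf.induction (Q := fun f => ∃ b : Fin 10 → ℝ, ∀ r s t : ℝ, r + s + t = 1 →
    f (r • p + s • q + t • w) =
      b 0 * r ^ 3 + b 1 * s ^ 3 + b 2 * t ^ 3 + b 3 * r ^ 2 * s + b 4 * r * s ^ 2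
        + b 5 * s ^ 2 * t + b 6 * s * t ^ 2 + b 7 * t ^ 2 * r + b 8 * t * r ^ 2
        + b 9 * r * s * t) ⟨0, by simp⟩ ?_ ?_
  · rintro f g ⟨b, hb⟩ ⟨c, hc⟩
    refine ⟨b + c, fun r s t h => ?_⟩
    simp only [hb r s t h, hc r s t h, Pi.add_apply]
    ring
  · intro c a b hab
    have prod3 : ∀ l : Fin 3 → Fin 3 → ℝ, ∃ b : Fin 10 → ℝ, ∀ r s t : ℝ,
        (l 0 0 * r + l 0 1 * s + l 0 2 * t) * (l 1 0 * r + l 1 1 * s + l 1 2 * t)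
          * (l 2 0 * r + l 2 1 * s + l 2 2 * t) =
        b 0 * r ^ 3 + b 1 * s ^ 3 + b 2 * t ^ 3 + b 3 * r ^ 2 * s + b 4 * r * s ^ 2
        + b 5 * s ^ 2 * t + b 6 * s * t ^ 2 + b 7 * t ^ 2 * r + b 8 * t * r ^ 2
        + b 9 * r * s * t := by
      intro l
      refine ⟨![l 0 0 * l 1 0 * l 2 0, l 0 1 * l 1 1 * l 2 1, l 0 2 * l 1 2 * l 2 2,
        l 0 0 * l 1 0 * l 2 1 + l 0 0 * l 1 1 * l 2 0 + l 0 1 * l 1 0 * l 2 0,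
        l 0 0 * l 1 1 * l 2 1 + l 0 1 * l 1 1 * l 2 0 + l 0 1 * l 1 0 * l 2 1,
        l 0 1 * l 1 1 * l 2 2 + l 0 1 * l 1 2 * l 2 1 + l 0 2 * l 1 1 * l 2 1,
        l 0 1 * l 1 2 * l 2 2 + l 0 2 * l 1 2 * l 2 1 + l 0 2 * l 1 1 * l 2 2,
        l 0 2 * l 1 2 * l 2 0 + l 0 2 * l 1 0 * l 2 2 + l 0 0 * l 1 2 * l 2 2,
        l 0 2 * l 1 0 * l 2 0 + l 0 0 * l 1 0 * l 2 2 + l 0 0 * l 1 2 * l 2 0,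
        l 0 0 * l 1 1 * l 2 2 + l 0 0 * l 1 2 * l 2 1 + l 0 1 * l 1 0 * l 2 2
          + l 0 1 * l 1 2 * l 2 0 + l 0 2 * l 1 0 * l 2 1 + l 0 2 * l 1 1 * l 2 0], ?_⟩
      intro r s t
      simp only [Matrix.cons_val]
      ring
    let X : Fin 2 → Fin 3 → ℝ := fun a => ![p a, q a, w a]
    obtain ⟨l, hl⟩ : ∃ l : Fin 3 → Fin 3 → ℝ, ∀ r s t : ℝ, r + s + t = 1 →
        (r * p 0 + s * q 0 + t * w 0) ^ a * (r * p 1 + s * q 1 + t * w 1) ^ b =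
        (l 0 0 * r + l 0 1 * s + l 0 2 * t) * (l 1 0 * r + l 1 1 * s + l 1 2 * t)
          * (l 2 0 * r + l 2 1 * s + l 2 2 * t) := by
      refine ⟨![if 1 ≤ a then X 0 else if 1 ≤ a + b then X 1 else 1,
        if 2 ≤ a then X 0 else if 2 ≤ a + b then X 1 else 1,
        if 3 ≤ a then X 0 else if 3 ≤ a + b then X 1 else 1], fun r s t h => ?_⟩
      have ha : a ≤ 3 := by lia
      have hb : b ≤ 3 := by lia
      interval_cases a <;> interval_cases b <;> first | lia | (simp [X, h]; try ring)
    obtain ⟨b', hb'⟩ := prod3 l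
    refine ⟨c • b', fun r s t h => ?_⟩
    have := (hl r s t h).trans (hb' r s t)
    simp only [Pi.add_apply, Pi.smul_apply, smul_eq_mul]
    linear_combination c * this

theorem IsPoly1.add {k : ℕ} {f g : ℝ → ℝ} (hf : IsPoly1 k f) (hg : IsPoly1 k g) :
    IsPoly1 k fun s => f s + g s := by
  obtain ⟨p, hp, hf⟩ := hf
  obtain ⟨q, hq, hg⟩ := hg
  exact ⟨p + q, Polynomial.natDegree_add_le_of_degree_le hp hq,
    fun s hs => by simp [hf s hs, hg s hs]⟩

theorem IsPoly1.const_mul {k : ℕ} {f : ℝ → ℝ} (c : ℝ) (hf : IsPoly1 k f) :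
    IsPoly1 k fun s => c * f s := by
  obtain ⟨p, hp, hf⟩ := hf
  exact ⟨Polynomial.C c * p, (Polynomial.natDegree_C_mul_le c p).trans hp,
    fun s hs => by simp [hf s hs]⟩

theorem IsPoly1.eq_zero {f : ℝ → ℝ} (hf : IsPoly1 2 f) (h₀ : f 0 = 0) (h₁ : f 2⁻¹ = 0)
    (h₂ : f 1 = 0) {s : ℝ} (hs : s ∈ Set.Icc (0:ℝ) 1) : f s = 0 := by
  obtain ⟨p, hp, hf⟩ := hf
  rw [Polynomial.eq_quadratic_of_degree_le_two
    (Polynomial.degree_le_of_natDegree_le hp)] at hf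
  simp only [Polynomial.eval_add, Polynomial.eval_mul, Polynomial.eval_C, Polynomial.eval_pow,
    Polynomial.eval_X] at hf
  rw [hf 0 (by simp)] at h₀
  rw [hf 2⁻¹ (by norm_num)] at h₁
  rw [hf 1 (by simp)] at h₂
  rw [hf s hs]
  have e₀ : p.coeff 0 = 0 := by linarith
  have e₁ : p.coeff 1 = 0 := by linarith
  have e₂ : p.coeff 2 = 0 := by linarith
  simp [e₀, e₁, e₂]

/-! ### The space `Σ(K)` as a submodule -/

/-- The bilinear form `M ↦ xᵀ M y`. -/
def bilin (x y : V2) : Mat2 →ₗ[ℝ] ℝ where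
  toFun M := dot2 x (M.mulVec y)
  map_add' M N := by simp [dot2, Matrix.add_mulVec]; ring
  map_smul' c M := by simp [dot2, Matrix.smul_mulVec]; ring

theorem bilin_apply (x y : V2) (M : Mat2) : bilin x y M =
    x 0 * (M 0 0 * y 0 + M 0 1 * y 1) + x 1 * (M 1 0 * y 0 + M 1 1 * y 1) := by
  simp [bilin, dot2, Matrix.mulVec, dotProduct, Fin.sum_univ_two]

theorem bilin_smul_smul (a b : ℝ) (x y : V2) (M : Mat2) :
    bilin (a • x) (b • y) M = a * b * bilin x y M := by
  simp only [bilin_apply, Pi.smul_apply, smul_eq_mul]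
  ring

theorem bilin_vecMulVec (x y u w : V2) :
    bilin x y (Matrix.vecMulVec u w) = dot2 x u * dot2 w y := by
  simp only [bilin_apply, Matrix.vecMulVec_apply, dot2]
  ring

theorem bilin_ot (x y u : V2) : bilin x y (ot u) = dot2 x u * dot2 u y :=
  bilin_vecMulVec x y u u

theorem bilin_symm2 (x y : V2) (M : Mat2) :
    bilin x y (symm2 M) = 2⁻¹ * (bilin x y M + bilin y x M) := by
  simp only [bilin_apply, symm2, Matrix.smul_apply, Matrix.add_apply, Matrix.transpose_apply,
    smul_eq_mul]
  ring

theorem divMat_add {k : ℕ} {τ σ : V2 → Mat2} (hτ : IsPolyMat k τ) (hσ : IsPolyMat k σ) :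
    divMat (τ + σ) = divMat τ + divMat σ := by
  funext x i
  simp only [divMat, pd, Pi.add_apply, Matrix.add_apply, ← Finset.sum_add_distrib]
  refine Finset.sum_congr rfl fun j _ => ?_
  rw [fderiv_fun_add ((hτ i j).differentiable x) ((hσ i j).differentiable x)]
  rfl

theorem divMat_smul {k : ℕ} {τ : V2 → Mat2} (c : ℝ) (hτ : IsPolyMat k τ) :
    divMat (c • τ) = c • divMat τ := by
  funext x i
  simp only [divMat, pd, Pi.smul_apply, Matrix.smul_apply, smul_eq_mul, Finset.mul_sum]
  refine Finset.sum_congr rfl fun j _ => ?_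
  rw [fderiv_const_mul ((hτ i j).differentiable x)]
  rfl

/-- `Σ(K)` as a submodule of the space of matrix fields. -/
def sigmaSubmodule (v : Fin 3 → V2) : Submodule ℝ (V2 → Mat2) where
  carrier := SigmaSet v
  zero_mem' := by
    refine ⟨fun _ _ => PolyDeg.const 3 0, fun _ => Matrix.isSymm_zero, fun i => ?_,
      fun i => ⟨0, by simp, fun s _ => by simp [dot2]⟩⟩
    simpa [divMat, pd] using PolyDeg.const 1 0
  add_mem' := by
    rintro τ σ ⟨h₁, h₂, h₃, h₄⟩ ⟨k₁, k₂, k₃, k₄⟩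
    refine ⟨fun i j => (h₁ i j).add (k₁ i j), fun x => (h₂ x).add (k₂ x), fun i => ?_,
      fun i => ?_⟩
    · rw [divMat_add h₁ k₁]
      exact (h₃ i).add (k₃ i)
    · convert (h₄ i).add (k₄ i) using 2
      exact (bilin _ _).map_add _ _
  smul_mem' := by
    rintro c τ ⟨h₁, h₂, h₃, h₄⟩
    refine ⟨fun i j => (h₁ i j).const_mul c, fun x => (h₂ x).smul c, fun i => ?_, fun i => ?_⟩
    · rw [divMat_smul c h₁]
      exact (h₃ i).const_mul c
    · convert (h₄ i).const_mul c using 2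
      exact (bilin _ _).map_smul _ _

/-- The divergence of a combination of constant dyads acts by directional derivatives. -/
theorem divMat_ot {a b c : V2 → ℝ} {A B C : V2 →L[ℝ] ℝ} {x : V2} (p q w : V2)
    (ha : HasFDerivAt a A x) (hb : HasFDerivAt b B x) (hc : HasFDerivAt c C x) :
    divMat (fun y => a y • ot p + b y • ot q + c y • ot w) x
      = A p • p + B q • q + C w • w := by
  have expand : ∀ (L : V2 →L[ℝ] ℝ) (u : V2),
      L u = u 0 * L (Pi.single 0 1) + u 1 * L (Pi.single 1 1) := by
    intro L u
    conv_lhs => rw [pi_eq_sum_univ' u]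
    simp [Fin.sum_univ_two]
  funext i
  have key : ∀ j, pd (fun y => (a y • ot p + b y • ot q + c y • ot w) i j) j x =
      A (Pi.single j 1) * (p i * p j) + B (Pi.single j 1) * (q i * q j)
        + C (Pi.single j 1) * (w i * w j) := by
    intro j
    have h := ((ha.mul_const (p i * p j)).add (hb.mul_const (q i * q j))).add
      (hc.mul_const (w i * w j))
    have h' := DFunLike.congr_fun h.fderiv (Pi.single j 1)
    simp only [_root_.add_apply, _root_.smul_apply, smul_eq_mul] at h'
    refine Eq.trans ?_ (h'.trans (by ring))
    rfl
  simp only [divMat, key, Fin.sum_univ_two, Pi.add_apply, Pi.smul_apply, smul_eq_mul]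
  rw [expand A p, expand B q, expand C w]
  ring

/-! ### Barycentric coordinates and edge vectors -/

/-- The edge vector of `e i`, an unnormalized tangent. -/
def edgeVec (v : Fin 3 → V2) (i : Fin 3) : V2 := v (i+2) - v (i+1)

theorem sum_edgeVec (v : Fin 3 → V2) (i : Fin 3) :
    edgeVec v i + edgeVec v (i+1) + edgeVec v (i+2) = 0 := by
  fin_cases i <;> simp [edgeVec]

/-- The metric relations between vertices, barycentric coordinates `lam`, their gradients `g` and
edge vectors, in which `D` is twice the signed area of the triangle up to sign. -/
structure Frame (v : Fin 3 → V2) (lam : Fin 3 → V2 → ℝ) (g : Fin 3 → V2) (D : ℝ) : Prop where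
  lin : ∀ ℓ x, lam ℓ x = dot2 (g ℓ) x + lam ℓ 0
  vert : ∀ ℓ m, lam ℓ (v m) = if ℓ = m then 1 else 0
  edge : ∀ i, edgeVec v i = ![-(D * g i 1), D * g i 0]
  sum_grad : ∀ a, g 0 a + g 1 a + g 2 a = 0
  cross : D ^ 2 * (g 0 0 * g 1 1 - g 0 1 * g 1 0) ^ 2 = 1
  sum_lam : ∀ x, lam 0 x + lam 1 x + lam 2 x = 1
  bary : ∀ x, lam 0 x • v 0 + lam 1 x • v 1 + lam 2 x • v 2 = x

theorem exists_frame {v : Fin 3 → V2} {lam : Fin 3 → V2 → ℝ} {g : Fin 3 → V2}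
    (hlin : ∀ ℓ x, lam ℓ x = dot2 (g ℓ) x + lam ℓ 0)
    (hvert : ∀ ℓ m, lam ℓ (v m) = if ℓ = m then 1 else 0) : ∃ D, Frame v lam g D := by
  have diff : ∀ l a b, g l 0 * (v a 0 - v b 0) + g l 1 * (v a 1 - v b 1)
      = (if l = a then 1 else 0) - (if l = b then 1 else 0) := by
    intro l a b
    rw [← hvert l a, ← hvert l b, hlin l (v a), hlin l (v b)]
    simp only [dot2]
    ring
  have h0p := diff 0 1 0
  have h0q := diff 0 2 0
  have h1p := diff 1 1 0
  have h1q := diff 1 2 0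
  have h2p := diff 2 1 0
  have h2q := diff 2 2 0
  simp at h0p h0q h1p h1q h2p h2q
  obtain ⟨d, hd⟩ : ∃ d, d = (v 1 0 - v 0 0) * (v 2 1 - v 0 1)
    - (v 1 1 - v 0 1) * (v 2 0 - v 0 0) := ⟨_, rfl⟩
  have hdet : d * (g 1 0 * g 2 1 - g 1 1 * g 2 0) = 1 := by
    rw [hd]
    linear_combination (g 2 0 * (v 2 0 - v 0 0) + g 2 1 * (v 2 1 - v 0 1)) * h1p + h2q
      - (g 2 0 * (v 1 0 - v 0 0) + g 2 1 * (v 1 1 - v 0 1)) * h1q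
  have hd0 : d ≠ 0 := left_ne_zero_of_mul_eq_one hdet
  have e10 : d * g 1 0 = v 2 1 - v 0 1 := by
    rw [hd]; linear_combination (v 2 1 - v 0 1) * h1p - (v 1 1 - v 0 1) * h1q
  have e11 : d * g 1 1 = -(v 2 0 - v 0 0) := by
    rw [hd]; linear_combination -(v 2 0 - v 0 0) * h1p + (v 1 0 - v 0 0) * h1q
  have e20 : d * g 2 0 = -(v 1 1 - v 0 1) := by
    rw [hd]; linear_combination (v 2 1 - v 0 1) * h2p - (v 1 1 - v 0 1) * h2q
  have e21 : d * g 2 1 = v 1 0 - v 0 0 := by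
    rw [hd]; linear_combination -(v 2 0 - v 0 0) * h2p + (v 1 0 - v 0 0) * h2q
  have e00 : d * g 0 0 = (v 1 1 - v 0 1) - (v 2 1 - v 0 1) := by
    rw [hd]; linear_combination (v 2 1 - v 0 1) * h0p - (v 1 1 - v 0 1) * h0q
  have e01 : d * g 0 1 = (v 2 0 - v 0 0) - (v 1 0 - v 0 0) := by
    rw [hd]; linear_combination -(v 2 0 - v 0 0) * h0p + (v 1 0 - v 0 0) * h0q
  have sum_grad : ∀ a, g 0 a + g 1 a + g 2 a = 0 := by
    intro a
    refine mul_left_cancel₀ hd0 ?_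
    fin_cases a
    · change d * (g 0 0 + g 1 0 + g 2 0) = d * 0
      linear_combination e00 + e10 + e20
    · change d * (g 0 1 + g 1 1 + g 2 1) = d * 0
      linear_combination e01 + e11 + e21
  have hlam0 : ∀ l, lam l 0 = (if l = 0 then 1 else 0) - (g l 0 * v 0 0 + g l 1 * v 0 1) := by
    intro l
    rw [← hvert l 0, hlin l (v 0)]
    simp only [dot2]
    ring
  have lam_eq : ∀ l x, lam l x = (if l = 0 then 1 else 0)
      + g l 0 * (x 0 - v 0 0) + g l 1 * (x 1 - v 0 1) := by
    intro l x
    rw [hlin, hlam0]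
    simp only [dot2]
    ring
  refine ⟨-d, hlin, hvert, fun i => ?_, sum_grad, ?_, fun x => ?_, fun x => ?_⟩
  · funext a
    fin_cases i <;> fin_cases a <;> simp [edgeVec] <;> linarith
  · have h2 : g 2 0 = -g 0 0 - g 1 0 := by linarith [sum_grad 0]
    have h2' : g 2 1 = -g 0 1 - g 1 1 := by linarith [sum_grad 1]
    have : d * (g 0 0 * g 1 1 - g 0 1 * g 1 0) = 1 := by
      rw [← hdet, h2, h2']; ring
    linear_combination (d * (g 0 0 * g 1 1 - g 0 1 * g 1 0) + 1) * this
  · rw [lam_eq, lam_eq, lam_eq]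
    simp
    linear_combination (x 0 - v 0 0) * sum_grad 0 + (x 1 - v 0 1) * sum_grad 1
  · funext a
    simp only [Pi.add_apply, Pi.smul_apply, smul_eq_mul]
    rw [lam_eq, lam_eq, lam_eq]
    fin_cases a
    · simp
      refine mul_left_cancel₀ hd0 ?_
      linear_combination (x 0 - v 0 0) * (v 0 0 * e00 + v 1 0 * e10 + v 2 0 * e20 - hd)
        + (x 1 - v 0 1) * (v 0 0 * e01 + v 1 0 * e11 + v 2 0 * e21)
    · simp
      refine mul_left_cancel₀ hd0 ?_
      linear_combination (x 0 - v 0 0) * (v 0 1 * e00 + v 1 1 * e10 + v 2 1 * e20)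
        + (x 1 - v 0 1) * (v 0 1 * e01 + v 1 1 * e11 + v 2 1 * e21 - hd)

namespace Frame

variable {v : Fin 3 → V2} {lam : Fin 3 → V2 → ℝ} {g : Fin 3 → V2} {D : ℝ}

theorem D_ne_zero (F : Frame v lam g D) : D ≠ 0 := by
  rintro rfl
  simpa using F.cross

theorem sum_lam' (F : Frame v lam g D) (i : Fin 3) (x : V2) :
    lam i x + lam (i+1) x + lam (i+2) x = 1 := by
  have := F.sum_lam x
  fin_cases i <;> simp <;> linarith

theorem bary' (F : Frame v lam g D) (i : Fin 3) (x : V2) :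
    lam i x • v i + lam (i+1) x • v (i+1) + lam (i+2) x • v (i+2) = x := by
  conv_rhs => rw [← F.bary x]
  fin_cases i <;> simp <;> abel

theorem grad_edgeVec (F : Frame v lam g D) (a b : Fin 3) :
    dot2 (g a) (edgeVec v b) = if a = b + 2 then 1 else if a = b + 1 then -1 else 0 := by
  have h : dot2 (g a) (edgeVec v b) = lam a (v (b+2)) - lam a (v (b+1)) := by
    rw [F.lin a (v (b+2)), F.lin a (v (b+1))]
    simp only [dot2, edgeVec, Pi.sub_apply]
    ring
  rw [h, F.vert, F.vert]
  fin_cases a <;> fin_cases b <;> simp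

theorem edgeVec_edgeVec (F : Frame v lam g D) (a b : Fin 3) :
    dot2 (edgeVec v a) (edgeVec v b) = D ^ 2 * cc g a b := by
  rw [F.edge, F.edge]
  simp only [dot2, cc, Matrix.cons_val]
  ring

theorem cc_self_pos (F : Frame v lam g D) (i : Fin 3) : 0 < cc g i i := by
  have h2 : g 2 0 = -g 0 0 - g 1 0 := by linarith [F.sum_grad 0]
  have h2' : g 2 1 = -g 0 1 - g 1 1 := by linarith [F.sum_grad 1]
  have hne : g i 0 ≠ 0 ∨ g i 1 ≠ 0 := by
    by_contra! h
    have hc := F.cross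
    have : g 0 0 * g 1 1 - g 0 1 * g 1 0 = 0 := by
      fin_cases i <;> simp at h
      · rw [h.1, h.2]; ring
      · rw [h.1, h.2]; ring
      · have e : g 1 0 = -g 0 0 := by linarith [h.1]
        have e' : g 1 1 = -g 0 1 := by linarith [h.2]
        rw [e, e']; ring
    simp [this] at hc
  simp only [cc, dot2]
  rcases hne with h | h
  · nlinarith [mul_self_pos.2 h, mul_self_nonneg (g i 1)]
  · nlinarith [mul_self_pos.2 h, mul_self_nonneg (g i 0)]

theorem cc_sum (F : Frame v lam g D) (i : Fin 3) :
    cc g i i + cc g i (i+1) + cc g i (i+2) = 0 := by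
  have h2 : g 2 0 = -g 0 0 - g 1 0 := by linarith [F.sum_grad 0]
  have h2' : g 2 1 = -g 0 1 - g 1 1 := by linarith [F.sum_grad 1]
  fin_cases i <;> simp [cc, dot2, h2, h2'] <;> ring

theorem elen_sq (F : Frame v lam g D) (i : Fin 3) : elen v i ^ 2 = D ^ 2 * cc g i i := by
  rw [← F.edgeVec_edgeVec, elen, norm2, Real.sq_sqrt]
  · rfl
  · simp only [dot2]
    nlinarith [mul_self_nonneg ((v (i+2) - v (i+1)) 0), mul_self_nonneg ((v (i+2) - v (i+1)) 1)]

theorem elen_ne_zero (F : Frame v lam g D) (i : Fin 3) : elen v i ≠ 0 := by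
  intro h
  have := F.elen_sq i
  rw [h] at this
  have h2 := mul_pos (sq_pos_of_ne_zero F.D_ne_zero) (F.cc_self_pos i)
  linarith

theorem nrml_eq (F : Frame v lam g D) (i : Fin 3) : nrml v i = ((elen v i)⁻¹ * D) • g i := by
  have h : tang v i = (elen v i)⁻¹ • edgeVec v i := rfl
  rw [nrml, h, F.edge]
  funext a
  fin_cases a <;> simp [rot] <;> ring

theorem lam_edgePt (F : Frame v lam g D) (l i : Fin 3) (s : ℝ) :
    lam l (edgePt v i s) = if l = i then 0 else if l = i + 1 then 1 - s else s := by
  have h : lam l (edgePt v i s) = lam l (v (i+1)) + s * dot2 (g l) (edgeVec v i) := by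
    rw [F.lin l (v (i+1)), F.lin l (edgePt v i s)]
    simp only [dot2, edgePt, edgeVec, Pi.add_apply, Pi.smul_apply, Pi.sub_apply, smul_eq_mul]
    ring
  rw [h, F.vert, F.grad_edgeVec]
  fin_cases l <;> fin_cases i <;> simp <;> ring

theorem polyDeg_lam (F : Frame v lam g D) (l : Fin 3) : PolyDeg 1 (lam l) := by
  have h : lam l = fun x => g l 0 * x 0 + g l 1 * x 1 + lam l 0 := by
    funext x
    rw [F.lin]
    rfl
  rw [h]
  exact (((PolyDeg.coord 0).const_mul _).add ((PolyDeg.coord 1).const_mul _)).add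
    (PolyDeg.const 1 _)

theorem exists_hasFDerivAt (F : Frame v lam g D) :
    ∃ G : Fin 3 → V2 →L[ℝ] ℝ, (∀ l x, HasFDerivAt (lam l) (G l) x) ∧
      ∀ l w, G l w = dot2 (g l) w := by
  let G : Fin 3 → V2 →L[ℝ] ℝ := fun l =>
    g l 0 • ContinuousLinearMap.proj 0 + g l 1 • ContinuousLinearMap.proj 1
  have hG : ∀ l w, G l w = dot2 (g l) w := fun l w => by simp [G, dot2]
  refine ⟨G, fun l x => ?_, hG⟩
  have h : lam l = fun x => G l x + lam l 0 := by
    funext x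
    rw [hG, F.lin]
  rw [h]
  exact (G l).hasFDerivAt.add_const _

end Frame

theorem dot2_comm (x y : V2) : dot2 x y = dot2 y x := by
  simp only [dot2]
  ring

theorem ot_isSymm (u : V2) : (ot u).IsSymm := by
  ext i j
  simp [ot, Matrix.vecMulVec_apply, mul_comm]

theorem symm2_isSymm (M : Mat2) : (symm2 M).IsSymm := by
  ext i j
  simp [symm2]
  ring

theorem psi_eq (v : Fin 3 → V2) (lam : Fin 3 → V2 → ℝ) (g : Fin 3 → V2) (i : Fin 3) :
    psi v lam g i = fun x =>
      ((0 * lam i x + (6 * cc g i (i+1) - 9 * cc g i (i+2)) * lam (i+1) x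
          + (9 * cc g i (i+1) - 6 * cc g i (i+2)) * lam (i+2) x)
          * lam (i+1) x * lam (i+2) x) • ot (edgeVec v i)
      + ((0 * lam i x + 0 * lam (i+1) x + -10 * cc g i (i+2) * lam (i+2) x)
          * lam (i+1) x * lam (i+2) x
        + (0 * lam i x + (6 * cc g i (i+1) - 9 * cc g i (i+2)) * lam (i+1) x
          + (2 * cc g i (i+2) - 3 * cc g i (i+1)) * lam (i+2) x)
          * lam (i+2) x * lam i x) • ot (edgeVec v (i+1))
      + ((-10 * cc g i (i+1) * lam i x + 0 * lam (i+1) x + -10 * cc g i (i+1) * lam (i+2) x)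
          * lam (i+1) x * lam (i+2) x
        + (0 * lam i x + (3 * cc g i (i+2) - 2 * cc g i (i+1)) * lam (i+1) x
          + (9 * cc g i (i+1) - 6 * cc g i (i+2)) * lam (i+2) x)
          * lam i x * lam (i+1) x) • ot (edgeVec v (i+2)) := by
  have e0 : tv v (i+1) (i+2) = edgeVec v i := rfl
  have e1 : tv v (i+2) i = edgeVec v (i+1) := by fin_cases i <;> rfl
  have e2 : tv v i (i+1) = edgeVec v (i+2) := by fin_cases i <;> rfl
  funext x
  rw [psi, e0, e1, e2]
  module

namespace Frame

variable {v : Fin 3 → V2} {lam : Fin 3 → V2 → ℝ} {g : Fin 3 → V2} {D : ℝ}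

/-! ### Membership in `Σ(K)` -/

theorem polyDeg_cubic (F : Frame v lam g D) (i r s : Fin 3) (a b c : ℝ) :
    PolyDeg 3 fun x => (a * lam i x + b * lam (i+1) x + c * lam (i+2) x) * lam r x * lam s x :=
  (((((F.polyDeg_lam i).const_mul a).add ((F.polyDeg_lam (i+1)).const_mul b)).add
    ((F.polyDeg_lam (i+2)).const_mul c)).mul (F.polyDeg_lam r)).mul (F.polyDeg_lam s)

theorem hasFDerivAt_cubic (F : Frame v lam g D) (i r s : Fin 3) (a b c : ℝ) (x : V2) :
    ∃ A : V2 →L[ℝ] ℝ, HasFDerivAt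
      (fun x => (a * lam i x + b * lam (i+1) x + c * lam (i+2) x) * lam r x * lam s x) A x ∧
      ∀ w, A w = (a * dot2 (g i) w + b * dot2 (g (i+1)) w + c * dot2 (g (i+2)) w)
          * lam r x * lam s x
        + (a * lam i x + b * lam (i+1) x + c * lam (i+2) x)
          * (dot2 (g r) w * lam s x + lam r x * dot2 (g s) w) := by
  obtain ⟨G, hG, hGw⟩ := F.exists_hasFDerivAt
  refine ⟨_, (((((hG i x).const_mul a).add ((hG (i+1) x).const_mul b)).add
    ((hG (i+2) x).const_mul c)).mul (hG r x)).mul (hG s x), fun w => ?_⟩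
  simp only [_root_.add_apply, _root_.smul_apply, smul_eq_mul, hGw, Pi.add_apply, Pi.mul_apply]
  ring

theorem dot_grad_edgeVec (F : Frame v lam g D) (i : Fin 3) :
    dot2 (g i) (edgeVec v i) = 0 ∧ dot2 (g (i+1)) (edgeVec v i) = -1 ∧
    dot2 (g (i+2)) (edgeVec v i) = 1 ∧ dot2 (g i) (edgeVec v (i+1)) = 1 ∧
    dot2 (g (i+1)) (edgeVec v (i+1)) = 0 ∧ dot2 (g (i+2)) (edgeVec v (i+1)) = -1 ∧
    dot2 (g i) (edgeVec v (i+2)) = -1 ∧ dot2 (g (i+1)) (edgeVec v (i+2)) = 1 ∧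
    dot2 (g (i+2)) (edgeVec v (i+2)) = 0 := by
  fin_cases i <;> simp [F.grad_edgeVec]

/-- The shear condition in `Σ(K)` only involves `e_iᵀ τ ∇λ_i`. -/
theorem isPoly1_shear_iff (F : Frame v lam g D) (τ : V2 → Mat2) (i : Fin 3) :
    (IsPoly1 2 fun s => dot2 (tang v i) ((τ (edgePt v i s)).mulVec (nrml v i))) ↔
      IsPoly1 2 fun s => bilin (edgeVec v i) (g i) (τ (edgePt v i s)) := by
  have h : ∀ s, dot2 (tang v i) ((τ (edgePt v i s)).mulVec (nrml v i)) =
      ((elen v i)⁻¹ * ((elen v i)⁻¹ * D)) * bilin (edgeVec v i) (g i) (τ (edgePt v i s)) := by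
    intro s
    rw [F.nrml_eq, ← bilin_smul_smul]
    rfl
  have hne := F.elen_ne_zero i
  have hD := F.D_ne_zero
  simp only [h]
  refine ⟨fun hp => ?_, fun hp => hp.const_mul _⟩
  convert hp.const_mul ((elen v i)⁻¹ * ((elen v i)⁻¹ * D))⁻¹ using 2
  field_simp

theorem quadratic_mem (F : Frame v lam g D) (a b : Fin 3) {M : Mat2} (hM : M.IsSymm) :
    (fun x => (lam a x * lam b x) • M) ∈ sigmaSubmodule v := by
  obtain ⟨G, hG, hGw⟩ := F.exists_hasFDerivAt
  refine ⟨fun i j => ?_, fun x => hM.smul _, fun i => ?_, fun i => ?_⟩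
  · simp only [Matrix.smul_apply, smul_eq_mul]
    refine PolyDeg.mono (k := 2) ?_ (by norm_num)
    exact ((F.polyDeg_lam a).mul (F.polyDeg_lam b)).mul (PolyDeg.const 0 (M i j))
  · have key : ∀ j x, pd (fun y => ((lam a y * lam b y) • M) i j) j x =
        (G a (Pi.single j 1) * M i j) * lam b x + (G b (Pi.single j 1) * M i j) * lam a x := by
      intro j x
      have h := (((hG a x).mul (hG b x)).mul_const (M i j)).fderiv
      have h' := DFunLike.congr_fun h (Pi.single j 1)
      simp only [_root_.add_apply, _root_.smul_apply, smul_eq_mul] at h'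
      exact Eq.trans rfl (h'.trans (by ring))
    simp only [divMat, key, Fin.sum_univ_two]
    have hp : ∀ c d, PolyDeg 1 fun x => c * lam b x + d * lam a x := fun c d =>
      ((F.polyDeg_lam b).const_mul c).add ((F.polyDeg_lam a).const_mul d)
    exact (hp _ _).add (hp _ _)
  · rw [F.isPoly1_shear_iff (fun x => (lam a x * lam b x) • M)]
    have affine : ∀ l, ∃ α β : ℝ, ∀ s, lam l (edgePt v i s) = α + β * s := by
      intro l
      simp only [F.lam_edgePt]
      split_ifs
      · exact ⟨0, 0, by simp⟩
      · exact ⟨1, -1, fun s => by ring⟩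
      · exact ⟨0, 1, fun s => by ring⟩
    obtain ⟨α, β, h⟩ := affine a
    obtain ⟨α', β', h'⟩ := affine b
    refine ⟨(Polynomial.C α + Polynomial.C β * Polynomial.X)
      * (Polynomial.C α' + Polynomial.C β' * Polynomial.X)
      * Polynomial.C (bilin (edgeVec v i) (g i) M), by compute_degree, fun s _ => ?_⟩
    simp [h, h']

theorem bilin_psi_own (F : Frame v lam g D) (i : Fin 3) (y : V2) {x : V2} (hx : lam i x = 0) :
    bilin y (g i) (psi v lam g i x) = -10 * lam (i+1) x * lam (i+2) x ^ 2 *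
      (cc g i (i+2) * dot2 y (edgeVec v (i+1)) - cc g i (i+1) * dot2 y (edgeVec v (i+2))) := by
  obtain ⟨h₁, -, -, h₂, -, -, h₃, -⟩ := F.dot_grad_edgeVec i
  simp only [psi_eq, map_add, map_smul, smul_eq_mul, bilin_ot, dot2_comm _ (g i), h₁, h₂, h₃, hx]
  ring

theorem bilin_psi_other (F : Frame v lam g D) {i l : Fin 3} (hl : l ≠ i) (y : V2) {x : V2}
    (hx : lam l x = 0) : bilin y (g l) (psi v lam g i x) = 0 := by
  obtain ⟨-, -, -, -, h₁, -, -, -, h₂⟩ := F.dot_grad_edgeVec i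
  obtain rfl | rfl : l = i + 1 ∨ l = i + 2 := by
    fin_cases i <;> fin_cases l <;> simp_all
  · simp only [psi_eq, map_add, map_smul, smul_eq_mul, bilin_ot, dot2_comm _ (g (i+1)), h₁, hx]
    ring
  · simp only [psi_eq, map_add, map_smul, smul_eq_mul, bilin_ot, dot2_comm _ (g (i+2)), h₂, hx]
    ring

theorem psi_vertex (F : Frame v lam g D) (i l : Fin 3) : psi v lam g i (v l) = 0 := by
  simp only [psi_eq, F.vert]
  fin_cases i <;> fin_cases l <;> simp

theorem psi_mem (F : Frame v lam g D) (i : Fin 3) : psi v lam g i ∈ sigmaSubmodule v := by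
  have hlam : ∀ x, lam (i+2) x = 1 - lam i x - lam (i+1) x := fun x => by
    linarith [F.sum_lam' i x]
  refine ⟨fun a b => ?_, fun x => ?_, fun a => ?_, fun l => ?_⟩
  · rw [psi_eq]
    simp only [Matrix.add_apply, Matrix.smul_apply, smul_eq_mul]
    have hp : ∀ {f : V2 → ℝ} (c : ℝ), PolyDeg 3 f → PolyDeg 3 fun x => f x * c :=
      fun c hf => hf.mul (PolyDeg.const 0 c)
    exact ((hp _ (F.polyDeg_cubic ..)).add
      (hp _ ((F.polyDeg_cubic ..).add (F.polyDeg_cubic ..)))).add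
      (hp _ ((F.polyDeg_cubic ..).add (F.polyDeg_cubic ..)))
  · rw [psi_eq]
    exact (((ot_isSymm _).smul _).add ((ot_isSymm _).smul _)).add ((ot_isSymm _).smul _)
  · have key : ∀ x, divMat (psi v lam g i) x =
        (cc g i (i+1) * (6 - 6 * lam i x - 12 * lam (i+1) x)
          + cc g i (i+2) * (4 * lam i x + 13 * lam (i+1) x - 4)) • edgeVec v (i+1)
        + (cc g i (i+1) * (lam i x - 3 * lam (i+1) x - 1)
          + cc g i (i+2) * (6 * lam i x + 12 * lam (i+1) x - 6)) • edgeVec v (i+2) := by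
      intro x
      obtain ⟨A, hA, hAw⟩ := F.hasFDerivAt_cubic i (i+1) (i+2) 0
        (6 * cc g i (i+1) - 9 * cc g i (i+2)) (9 * cc g i (i+1) - 6 * cc g i (i+2)) x
      obtain ⟨B, hB, hBw⟩ := F.hasFDerivAt_cubic i (i+1) (i+2) 0 0 (-10 * cc g i (i+2)) x
      obtain ⟨B', hB', hBw'⟩ := F.hasFDerivAt_cubic i (i+2) i 0
        (6 * cc g i (i+1) - 9 * cc g i (i+2)) (2 * cc g i (i+2) - 3 * cc g i (i+1)) x
      obtain ⟨C, hC, hCw⟩ := F.hasFDerivAt_cubic i (i+1) (i+2) (-10 * cc g i (i+1)) 0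
        (-10 * cc g i (i+1)) x
      obtain ⟨C', hC', hCw'⟩ := F.hasFDerivAt_cubic i i (i+1) 0
        (3 * cc g i (i+2) - 2 * cc g i (i+1)) (9 * cc g i (i+1) - 6 * cc g i (i+2)) x
      obtain ⟨d₁, d₂, d₃, d₄, d₅, d₆, d₇, d₈, d₉⟩ := F.dot_grad_edgeVec i
      rw [psi_eq]
      refine (divMat_ot _ _ _ hA (hB.add hB') (hC.add hC')).trans ?_
      have he : edgeVec v i = -edgeVec v (i+1) - edgeVec v (i+2) := by
        linear_combination (exp := 1) sum_edgeVec v i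
      simp only [_root_.add_apply, hAw, hBw, hBw', hCw, hCw', d₁, d₂, d₃, d₄, d₅, d₆, d₇, d₈, d₉,
        hlam]
      rw [he]
      module
    have h₁ : PolyDeg 1 (lam i) := F.polyDeg_lam i
    have h₂ : PolyDeg 1 (lam (i+1)) := F.polyDeg_lam (i+1)
    have hp : ∀ α β γ : ℝ, PolyDeg 1 fun x => α * lam i x + β * lam (i+1) x + γ :=
      fun α β γ => ((h₁.const_mul α).add (h₂.const_mul β)).add (PolyDeg.const 1 γ)
    simp only [key, Pi.add_apply, Pi.smul_apply, smul_eq_mul]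
    convert ((hp (-6 * cc g i (i+1) + 4 * cc g i (i+2)) (-12 * cc g i (i+1) + 13 * cc g i (i+2))
      (6 * cc g i (i+1) - 4 * cc g i (i+2))).const_mul (edgeVec v (i+1) a)).add
      ((hp (cc g i (i+1) + 6 * cc g i (i+2)) (-3 * cc g i (i+1) + 12 * cc g i (i+2))
      (-cc g i (i+1) - 6 * cc g i (i+2))).const_mul (edgeVec v (i+2) a)) using 2
    ring
  · rw [F.isPoly1_shear_iff (psi v lam g i)]
    refine ⟨0, by simp, fun s _ => ?_⟩
    have hs : lam l (edgePt v l s) = 0 := by simp [F.lam_edgePt]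
    rw [Polynomial.eval_zero]
    change bilin (edgeVec v l) (g l) (psi v lam g i (edgePt v l s)) = 0
    by_cases h : l = i
    · subst h
      rw [F.bilin_psi_own l _ hs, F.edgeVec_edgeVec, F.edgeVec_edgeVec]
      ring
    · exact F.bilin_psi_other h _ hs

theorem basis21_mem (F : Frame v lam g D) (m : Fin 3 × Fin 7) :
    basis21 v lam g m ∈ sigmaSubmodule v := by
  obtain ⟨i, m⟩ := m
  have hsq : ∀ M : Mat2, M.IsSymm → (fun x => lam i x ^ 2 • M) ∈ sigmaSubmodule v := by
    intro M hM
    simpa only [sq] using F.quadratic_mem i i hM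
  have hnn := F.quadratic_mem (i+1) (i+2) (ot_isSymm (nrml v i))
  have hpsi := F.psi_mem i
  fin_cases m
  · exact hsq _ (by ext a b; fin_cases a <;> fin_cases b <;> rfl)
  · exact hsq _ (by ext a b; fin_cases a <;> fin_cases b <;> rfl)
  · exact hsq _ (by ext a b; fin_cases a <;> fin_cases b <;> rfl)
  · convert Submodule.sub_mem _ (Submodule.smul_mem _ 36 hnn) (Submodule.smul_mem _ 6 hpsi)
      using 1
    funext x
    simp only [basis21, phi1, Fin.reduceFinMk, Matrix.cons_val, Pi.sub_apply, Pi.smul_apply]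
    module
  · convert Submodule.add_mem _ (Submodule.smul_mem _ (-24) hnn) (Submodule.smul_mem _ 6 hpsi)
      using 1
    funext x
    simp only [basis21, phi2, Fin.reduceFinMk, Matrix.cons_val, Pi.add_apply, Pi.smul_apply]
    module
  · exact F.quadratic_mem _ _ (symm2_isSymm _)
  · exact F.quadratic_mem _ _ (ot_isSymm _)

/-! ### Degrees of freedom -/

/-- The degrees of freedom of `Σ(K)`: the entries at each vertex and, on each edge, the normal
component at two points and the shear and tangential components at the midpoint. -/
def dof (v g : Fin 3 → V2) : (V2 → Mat2) →ₗ[ℝ] Fin 3 × Fin 7 → ℝ :=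
  LinearMap.pi fun m =>
    (![bilin ![1, 0] ![1, 0] ∘ₗ LinearMap.proj (v m.1),
      bilin ![0, 1] ![0, 1] ∘ₗ LinearMap.proj (v m.1),
      bilin ![1, 0] ![0, 1] ∘ₗ LinearMap.proj (v m.1),
      bilin (g m.1) (g m.1) ∘ₗ LinearMap.proj (edgePt v m.1 (1/3)),
      bilin (g m.1) (g m.1) ∘ₗ LinearMap.proj (edgePt v m.1 (2/3)),
      bilin (edgeVec v m.1) (g m.1) ∘ₗ LinearMap.proj (edgePt v m.1 2⁻¹),
      bilin (edgeVec v m.1) (edgeVec v m.1) ∘ₗ LinearMap.proj (edgePt v m.1 2⁻¹)] :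
        Fin 7 → (V2 → Mat2) →ₗ[ℝ] ℝ) m.2

theorem bilin_sum_basis21 (v : Fin 3 → V2) (lam : Fin 3 → V2 → ℝ) (g : Fin 3 → V2)
    (c : Fin 3 × Fin 7 → ℝ) (y w x : V2) :
    bilin y w ((∑ m, c m • basis21 v lam g m) x) =
      ∑ i, ∑ m, c (i, m) * bilin y w (basis21 v lam g (i, m) x) := by
  rw [Finset.sum_apply, map_sum, Fintype.sum_prod_type]
  simp only [Pi.smul_apply, map_smul, smul_eq_mul]

/-- On the edge `e l`, only the fields attached to `e l` have a nonzero normal trace, apart from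
the vertex fields. -/
theorem bilin_basis21_other (F : Frame v lam g D) {i l : Fin 3} (hi : i ≠ l) (y : V2) {x : V2}
    (hx : lam l x = 0) (m : Fin 7) (hm : 3 ≤ m) :
    bilin y (g l) (basis21 v lam g (i, m) x) = 0 := by
  have hpsi := F.bilin_psi_other hi.symm y hx
  have h : lam (i+1) x * lam (i+2) x = 0 := by
    obtain rfl | rfl : l = i + 1 ∨ l = i + 2 := by
      fin_cases i <;> fin_cases l <;> simp_all
    · rw [hx, zero_mul]
    · rw [hx, mul_zero]
  fin_cases m <;> simp at hm
  · simp [basis21, phi1, hpsi, mul_assoc, h]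
  · simp [basis21, phi2, hpsi, mul_assoc, h]
  · simp [basis21, h]
  · simp [basis21, h]

theorem basis21_vertex (F : Frame v lam g D) (i l : Fin 3) (m : Fin 7) (hm : 3 ≤ m) :
    basis21 v lam g (i, m) (v l) = 0 := by
  have hpsi := F.psi_vertex i l
  have h : lam (i+1) (v l) * lam (i+2) (v l) = 0 := by
    simp only [F.vert]
    fin_cases i <;> fin_cases l <;> simp
  fin_cases m <;> simp at hm
  · simp [basis21, phi1, hpsi, mul_assoc, h]
  · simp [basis21, phi2, hpsi, mul_assoc, h]
  · simp [basis21, h]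
  · simp [basis21, h]

theorem dot_nrml_sq (F : Frame v lam g D) (i : Fin 3) :
    dot2 (g i) (nrml v i) * dot2 (nrml v i) (g i) = cc g i i := by
  have hne := F.elen_ne_zero i
  have h : dot2 (g i) (nrml v i) = (elen v i)⁻¹ * D * cc g i i := by
    rw [F.nrml_eq]
    simp only [cc, dot2, Pi.smul_apply, smul_eq_mul]
    ring
  rw [dot2_comm (nrml v i), h]
  field_simp
  rw [F.elen_sq]
  ring

theorem dot_tang (F : Frame v lam g D) (i : Fin 3) :
    dot2 (g i) (tang v i) = 0 ∧ dot2 (edgeVec v i) (tang v i) ≠ 0 ∧ dot2 (nrml v i) (g i) ≠ 0 := by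
  have hne := F.elen_ne_zero i
  have hcc := (F.cc_self_pos i).ne'
  have hD := F.D_ne_zero
  have h₀ := (F.dot_grad_edgeVec i).1
  have ht : tang v i = (elen v i)⁻¹ • edgeVec v i := rfl
  have smul_right : ∀ (x y : V2) (c : ℝ), dot2 x (c • y) = c * dot2 x y := fun x y c => by
    simp only [dot2, Pi.smul_apply, smul_eq_mul]
    ring
  refine ⟨?_, ?_, fun h => ?_⟩
  · rw [ht, smul_right, h₀, mul_zero]
  · rw [ht, smul_right, F.edgeVec_edgeVec]
    positivity
  · apply hcc
    rw [← F.dot_nrml_sq i, h, mul_zero]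

theorem dof_basis21_injective (F : Frame v lam g D) {c : Fin 3 × Fin 7 → ℝ}
    (hc : dof v g (∑ m, c m • basis21 v lam g m) = 0) : c = 0 := by
  have hm := fun i m => congr_fun hc (i, m)
  have vertex : ∀ l, c (l, 0) = 0 ∧ c (l, 1) = 0 ∧ c (l, 2) = 0 := by
    intro l
    have hb : ∀ y w, bilin y w ((∑ m, c m • basis21 v lam g m) (v l)) =
        c (l, 0) * (y 0 * w 0) + c (l, 1) * (y 1 * w 1)
          + c (l, 2) * (y 0 * w 1 + y 1 * w 0) := by
      intro y w
      rw [bilin_sum_basis21, Finset.sum_eq_single l]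
      · simp only [Fin.sum_univ_seven]
        rw [F.basis21_vertex l l 3 (by decide), F.basis21_vertex l l 4 (by decide),
          F.basis21_vertex l l 5 (by decide), F.basis21_vertex l l 6 (by decide)]
        simp [basis21, F.vert, bilin_apply]
      · intro i _ hi
        refine Finset.sum_eq_zero fun m _ => ?_
        by_cases h3 : 3 ≤ m
        · rw [F.basis21_vertex i l m h3, map_zero, mul_zero]
        · fin_cases m <;> simp at h3 <;> simp [basis21, F.vert, hi, bilin_apply]
      · simp
    have h₀ : bilin ![1, 0] ![1, 0] ((∑ m, c m • basis21 v lam g m) (v l)) = 0 := hm l 0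
    have h₁ : bilin ![0, 1] ![0, 1] ((∑ m, c m • basis21 v lam g m) (v l)) = 0 := hm l 1
    have h₂ : bilin ![1, 0] ![0, 1] ((∑ m, c m • basis21 v lam g m) (v l)) = 0 := hm l 2
    rw [hb] at h₀ h₁ h₂
    simp at h₀ h₁ h₂
    exact ⟨h₀, h₁, h₂⟩
  have edge : ∀ l y s, bilin y (g l) ((∑ m, c m • basis21 v lam g m) (edgePt v l s)) =
      c (l, 3) * bilin y (g l) (basis21 v lam g (l, 3) (edgePt v l s))
      + c (l, 4) * bilin y (g l) (basis21 v lam g (l, 4) (edgePt v l s))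
      + c (l, 5) * bilin y (g l) (basis21 v lam g (l, 5) (edgePt v l s))
      + c (l, 6) * bilin y (g l) (basis21 v lam g (l, 6) (edgePt v l s)) := by
    intro l y s
    obtain ⟨h₀, h₁, h₂⟩ := vertex l
    rw [bilin_sum_basis21, Finset.sum_eq_single l]
    · simp only [Fin.sum_univ_seven, h₀, h₁, h₂]
      ring
    · intro i _ hi
      refine Finset.sum_eq_zero fun m _ => ?_
      by_cases h3 : 3 ≤ m
      · rw [F.bilin_basis21_other hi y (by simp [F.lam_edgePt]) m h3, mul_zero]
      · obtain ⟨k₀, k₁, k₂⟩ := vertex i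
        fin_cases m <;> simp at h3 <;> simp [k₀, k₁, k₂]
    · simp
  have lam₀ : ∀ l s, lam l (edgePt v l s) = 0 := fun l s => by simp [F.lam_edgePt]
  have lam₁ : ∀ l s, lam (l+1) (edgePt v l s) = 1 - s := fun l s => by simp [F.lam_edgePt]
  have lam₂ : ∀ l s, lam (l+2) (edgePt v l s) = s := fun l s => by simp [F.lam_edgePt]
  have normal : ∀ l, c (l, 3) = 0 ∧ c (l, 4) = 0 := by
    intro l
    have hpos := F.cc_self_pos l
    obtain ⟨ht, -⟩ := F.dot_tang l
    have hb : ∀ s, bilin (g l) (g l) ((∑ m, c m • basis21 v lam g m) (edgePt v l s)) =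
        cc g l l * ((1 - s) * s) * (c (l, 3) * (36 - 60 * s) + c (l, 4) * (-24 + 60 * s)) := by
      intro s
      obtain ⟨-, -, -, h₁, -, -, h₂, -⟩ := F.dot_grad_edgeVec l
      rw [edge]
      simp only [basis21, phi1, phi2, Matrix.cons_val, map_add, map_sub, map_smul, smul_eq_mul,
        bilin_symm2, bilin_vecMulVec, bilin_ot, F.dot_nrml_sq, ht, dot2_comm (tang v l),
        F.bilin_psi_own l _ (lam₀ l s), lam₁, lam₂, h₁, h₂]
      linear_combination (60 * (1 - s) * s ^ 2 * (c (l, 3) - c (l, 4))) * F.cc_sum l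
    have h₃ : bilin (g l) (g l) ((∑ m, c m • basis21 v lam g m) (edgePt v l (1/3))) = 0 := hm l 3
    have h₄ : bilin (g l) (g l) ((∑ m, c m • basis21 v lam g m) (edgePt v l (2/3))) = 0 := hm l 4
    rw [hb] at h₃ h₄
    have k₃ := (mul_eq_zero.1 h₃).resolve_left (mul_ne_zero hpos.ne' (by norm_num))
    have k₄ := (mul_eq_zero.1 h₄).resolve_left (mul_ne_zero hpos.ne' (by norm_num))
    constructor <;> linarith
  have shear : ∀ l, c (l, 5) = 0 := by
    intro l
    obtain ⟨h₀, h₂, h₃⟩ := F.dot_tang l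
    have h₅ : bilin (edgeVec v l) (g l) ((∑ m, c m • basis21 v lam g m) (edgePt v l 2⁻¹)) = 0 :=
      hm l 5
    rw [edge, (normal l).1, (normal l).2] at h₅
    simp only [basis21, Matrix.cons_val, map_smul, smul_eq_mul, bilin_symm2, bilin_vecMulVec,
      bilin_ot, h₀, dot2_comm (tang v l) (g l), lam₁, lam₂] at h₅
    have hne := mul_ne_zero h₂ h₃
    have : c (l, 5) * (dot2 (edgeVec v l) (tang v l) * dot2 (nrml v l) (g l)) = 0 := by
      linear_combination 8 * h₅
    exact (mul_eq_zero.1 this).resolve_right hne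
  have tangential : ∀ l, c (l, 6) = 0 := by
    intro l
    obtain ⟨-, h₂, -⟩ := F.dot_tang l
    have h₆ : bilin (edgeVec v l) (edgeVec v l)
      ((∑ m, c m • basis21 v lam g m) (edgePt v l 2⁻¹)) = 0 := hm l 6
    rw [bilin_sum_basis21, Finset.sum_eq_single l] at h₆
    · simp only [Fin.sum_univ_seven, vertex, normal, shear] at h₆
      simp only [basis21, Matrix.cons_val, map_smul, smul_eq_mul, bilin_ot, lam₁, lam₂,
        dot2_comm (tang v l)] at h₆
      have hne := mul_ne_zero h₂ h₂
      have : c (l, 6) * (dot2 (edgeVec v l) (tang v l) * dot2 (edgeVec v l) (tang v l)) = 0 := by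
        linear_combination 4 * h₆
      exact (mul_eq_zero.1 this).resolve_right hne
    · intro i _ hi
      simp only [Fin.sum_univ_seven, vertex, normal, shear]
      have h : lam (i+1) (edgePt v l 2⁻¹) * lam (i+2) (edgePt v l 2⁻¹) = 0 := by
        simp only [F.lam_edgePt]
        fin_cases i <;> fin_cases l <;> simp_all
      simp [basis21, h]
    · simp
  funext ⟨l, m⟩
  fin_cases m
  exacts [(vertex l).1, (vertex l).2.1, (vertex l).2.2, (normal l).1, (normal l).2, shear l,
    tangential l]

/-! ### Unisolvence -/

theorem eq_sum_ot (F : Frame v lam g D) {M : Mat2} (hM : M.IsSymm) :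
    M = -bilin (g 1) (g 2) M • ot (edgeVec v 0) + -bilin (g 2) (g 0) M • ot (edgeVec v 1)
      + -bilin (g 0) (g 1) M • ot (edgeVec v 2) := by
  have h2 : g 2 0 = -g 0 0 - g 1 0 := by linarith [F.sum_grad 0]
  have h2' : g 2 1 = -g 0 1 - g 1 1 := by linarith [F.sum_grad 1]
  have hs : M 1 0 = M 0 1 := hM.apply 0 1
  have hc := F.cross
  simp only [F.edge, bilin_apply, h2, h2', hs]
  ext a b
  fin_cases a <;> fin_cases b <;> simp [ot, hs]
  · linear_combination -M 0 0 * hc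
  · linear_combination -M 0 1 * hc
  · linear_combination -M 0 1 * hc
  · linear_combination -M 1 1 * hc

/-- A matrix annihilating `∇λ_i` in both the normal and tangential directions of `e i` annihilates
it altogether. -/
theorem bilin_eq_zero (F : Frame v lam g D) (i : Fin 3) {M : Mat2}
    (hn : bilin (g i) (g i) M = 0) (ht : bilin (edgeVec v i) (g i) M = 0) (y : V2) :
    bilin y (g i) M = 0 := by
  have hD := F.D_ne_zero
  have hcc := (F.cc_self_pos i).ne'
  rw [F.edge] at ht
  simp only [bilin_apply, Matrix.cons_val] at hn ht ⊢
  simp only [cc, dot2] at hcc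
  refine mul_left_cancel₀ (mul_ne_zero hD hcc) ?_
  linear_combination D * (y 0 * g i 0 + y 1 * g i 1) * hn + (y 1 * g i 0 - y 0 * g i 1) * ht

theorem cubic_of_edges (F : Frame v lam g D) (i : Fin 3) {f : V2 → ℝ} (hf : PolyDeg 3 f)
    (h₁ : ∀ s ∈ ({0, 1/3, 2/3, 1} : Set ℝ), f (edgePt v (i+1) s) = 0)
    (h₂ : ∀ s ∈ ({0, 1/3, 2/3, 1} : Set ℝ), f (edgePt v (i+2) s) = 0) :
    ∃ m p q, ∀ x, f x =
      (m * lam i x + p * lam (i+1) x + q * lam (i+2) x) * lam (i+1) x * lam (i+2) x := by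
  obtain ⟨b, hb⟩ := hf.bernstein (v i) (v (i+1)) (v (i+2))
  have hb' := fun x => hb _ _ _ (F.sum_lam' i x)
  simp only [F.bary'] at hb'
  simp only [hb', F.lam_edgePt] at h₁ h₂
  have k : i ≠ i + 1 ∧ i ≠ i + 2 ∧ i + 1 ≠ i + 2 ∧ i + 1 + 1 = i + 2 ∧ i + 2 + 1 = i := by
    fin_cases i <;> simp
  obtain ⟨k₁, k₂, k₃, k₄, k₅⟩ := k
  simp [k₁, k₂, k₃, k₄, k₅, k₁.symm, k₃.symm] at h₁ h₂
  norm_num at h₁ h₂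
  obtain ⟨h₁a, h₁b, h₁c, h₁d⟩ := h₁
  obtain ⟨h₂a, h₂b, h₂c, h₂d⟩ := h₂
  have e0 : b 0 = 0 := by linarith
  have e1 : b 1 = 0 := by linarith
  have e2 : b 2 = 0 := by linarith
  have e3 : b 3 = 0 := by linarith
  have e4 : b 4 = 0 := by linarith
  have e7 : b 7 = 0 := by linarith
  have e8 : b 8 = 0 := by linarith
  refine ⟨b 9, b 5, b 6, fun x => ?_⟩
  rw [hb', e0, e1, e2, e3, e4, e7, e8]
  ring

theorem eq_zero_of_dof (F : Frame v lam g D) {τ : V2 → Mat2} (hτ : τ ∈ SigmaSet v)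
    (h : dof v g τ = 0) : τ = 0 := by
  obtain ⟨hpoly, hsymm, hdiv, hshear⟩ := hτ
  have hm := fun i m => congr_fun h (i, m)
  have vertex : ∀ l, τ (v l) = 0 := by
    intro l
    have h₀ : bilin ![1, 0] ![1, 0] (τ (v l)) = 0 := hm l 0
    have h₁ : bilin ![0, 1] ![0, 1] (τ (v l)) = 0 := hm l 1
    have h₂ : bilin ![1, 0] ![0, 1] (τ (v l)) = 0 := hm l 2
    have h₃ : τ (v l) 1 0 = τ (v l) 0 1 := (hsymm (v l)).apply 0 1
    simp [bilin_apply] at h₀ h₁ h₂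
    ext a b
    fin_cases a <;> fin_cases b <;> simp [h₀, h₁, h₂, h₃]
  have edge_zero : ∀ i, edgePt v i 0 = v (i+1) := fun i => by simp [edgePt]
  have edge_one : ∀ i, edgePt v i 1 = v (i+2) := fun i => by simp [edgePt]
  have edge : ∀ i y, ∀ s ∈ ({0, 1/3, 2/3, 1} : Set ℝ), bilin y (g i) (τ (edgePt v i s)) = 0 := by
    intro i y s hs
    have shear : ∀ s ∈ Set.Icc (0:ℝ) 1, bilin (edgeVec v i) (g i) (τ (edgePt v i s)) = 0 := by
      intro s hs
      refine ((F.isPoly1_shear_iff τ i).1 (hshear i)).eq_zero ?_ (hm i 5) ?_ hs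
      · rw [edge_zero, vertex, map_zero]
      · rw [edge_one, vertex, map_zero]
    obtain rfl | rfl | rfl | rfl := hs
    · rw [edge_zero, vertex, map_zero]
    · exact F.bilin_eq_zero i (hm i 3) (shear _ (by norm_num)) y
    · exact F.bilin_eq_zero i (hm i 4) (shear _ (by norm_num)) y
    · rw [edge_one, vertex, map_zero]
  have bilin_symm : ∀ y w x, bilin y w (τ x) = bilin w y (τ x) := by
    intro y w x
    have h₃ : τ x 1 0 = τ x 0 1 := (hsymm x).apply 0 1
    simp only [bilin_apply, h₃]
    ring
  have form : ∀ i, ∃ m p q, ∀ x, -bilin (g (i+1)) (g (i+2)) (τ x) =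
      (m * lam i x + p * lam (i+1) x + q * lam (i+2) x) * lam (i+1) x * lam (i+2) x := by
    intro i
    refine F.cubic_of_edges i ?_ (fun s hs => ?_) (fun s hs => ?_)
    · have hp := fun (c : ℝ) a b => (hpoly a b).const_mul c
      have := (((hp (-(g (i+1) 0 * g (i+2) 0)) 0 0).add (hp (-(g (i+1) 0 * g (i+2) 1)) 0 1)).add
        (hp (-(g (i+1) 1 * g (i+2) 0)) 1 0)).add (hp (-(g (i+1) 1 * g (i+2) 1)) 1 1)
      convert this using 2
      rw [bilin_apply]
      ring
    · rw [bilin_symm, edge (i+1) _ s hs, neg_zero]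
    · rw [edge (i+2) _ s hs, neg_zero]
  choose m p q hmpq using form
  have hτ : τ = fun x =>
      ((m 0 * lam 0 x + p 0 * lam 1 x + q 0 * lam 2 x) * lam 1 x * lam 2 x) • ot (edgeVec v 0)
      + ((m 1 * lam 1 x + p 1 * lam 2 x + q 1 * lam 0 x) * lam 2 x * lam 0 x) • ot (edgeVec v 1)
      + ((m 2 * lam 2 x + p 2 * lam 0 x + q 2 * lam 1 x) * lam 0 x * lam 1 x)
        • ot (edgeVec v 2) := by
    funext x
    rw [← show _ = (m 0 * lam 0 x + p 0 * lam 1 x + q 0 * lam 2 x) * lam 1 x * lam 2 x from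
        hmpq 0 x,
      ← show _ = (m 1 * lam 1 x + p 1 * lam 2 x + q 1 * lam 0 x) * lam 2 x * lam 0 x from
        hmpq 1 x,
      ← show _ = (m 2 * lam 2 x + p 2 * lam 0 x + q 2 * lam 1 x) * lam 0 x * lam 1 x from
        hmpq 2 x]
    exact F.eq_sum_ot (hsymm x)
  have hq : ∀ i, q i = -p i := by
    intro i
    have h₆ : bilin (edgeVec v i) (edgeVec v i) (τ (edgePt v i 2⁻¹)) = 0 := hm i 6
    have hne : dot2 (edgeVec v i) (edgeVec v i) * dot2 (edgeVec v i) (edgeVec v i) ≠ 0 := by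
      rw [F.edgeVec_edgeVec]
      have := F.cc_self_pos i
      have := F.D_ne_zero
      positivity
    have : (p i + q i) * (dot2 (edgeVec v i) (edgeVec v i) *
        dot2 (edgeVec v i) (edgeVec v i)) = 0 := by
      rw [hτ] at h₆
      simp only [map_add, map_smul, smul_eq_mul, bilin_ot, F.lam_edgePt] at h₆
      fin_cases i <;> simp at h₆ ⊢ <;> grind
    linarith [(mul_eq_zero.1 this).resolve_right hne]
  let d : Fin 3 → V2 → ℝ := fun i x => -2 * p i * lam (i+1) x * lam (i+2) x
    + (m i * lam i x + p i * lam (i+1) x - p i * lam (i+2) x) * (lam (i+1) x - lam (i+2) x)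
  have div_eq : ∀ x, divMat τ x = d 0 x • edgeVec v 0 + d 1 x • edgeVec v 1
      + d 2 x • edgeVec v 2 := by
    intro x
    have deriv : ∀ i, ∃ A : V2 →L[ℝ] ℝ, HasFDerivAt (fun x => (m i * lam i x
        + p i * lam (i+1) x + q i * lam (i+2) x) * lam (i+1) x * lam (i+2) x) A x ∧
        A (edgeVec v i) = d i x := by
      intro i
      obtain ⟨A, hA, hAw⟩ := F.hasFDerivAt_cubic i (i+1) (i+2) (m i) (p i) (q i) x
      obtain ⟨d₀, d₁, d₂, -⟩ := F.dot_grad_edgeVec i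
      refine ⟨A, hA, ?_⟩
      rw [hAw, d₀, d₁, d₂, hq]
      ring
    obtain ⟨A, hA, hA'⟩ := deriv 0
    obtain ⟨B, hB, hB'⟩ := deriv 1
    obtain ⟨C, hC, hC'⟩ := deriv 2
    rw [hτ]
    refine (divMat_ot _ _ _ hA hB hC).trans ?_
    rw [hA', hB', hC']
  have grad_div : ∀ i x, dot2 (g i) (divMat τ x) = d (i+1) x - d (i+2) x := by
    intro i x
    obtain ⟨d₀, -, -, d₁, -, -, d₂, -⟩ := F.dot_grad_edgeVec i
    have hsum : divMat τ x = d i x • edgeVec v i + d (i+1) x • edgeVec v (i+1)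
        + d (i+2) x • edgeVec v (i+2) := by
      rw [div_eq]
      fin_cases i <;> simp <;> abel
    simp only [hsum, dot2, Pi.add_apply, Pi.smul_apply, smul_eq_mul] at d₀ d₁ d₂ ⊢
    linear_combination d i x * d₀ + d (i+1) x * d₁ + d (i+2) x * d₂
  have mid : ∀ i a b, 2 * (d (i+1) ((2:ℝ)⁻¹ • (v a + v b)) - d (i+2) ((2:ℝ)⁻¹ • (v a + v b))) =
      (d (i+1) (v a) - d (i+2) (v a)) + (d (i+1) (v b) - d (i+2) (v b)) := by
    intro i a b
    have hp : PolyDeg 1 fun x => dot2 (g i) (divMat τ x) :=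
      ((hdiv 0).const_mul (g i 0)).add ((hdiv 1).const_mul (g i 1))
    simpa only [grad_div] using hp.midpoint (v a) (v b)
  have lam_mid : ∀ l a b, lam l ((2:ℝ)⁻¹ • (v a + v b)) =
      ((if l = a then 1 else 0) + (if l = b then 1 else 0)) / 2 := by
    intro l a b
    rw [← F.vert l a, ← F.vert l b]
    linarith [(F.polyDeg_lam l).midpoint (v a) (v b)]
  have e₁ := mid 0 0 1
  have e₂ := mid 0 1 2
  have e₃ := mid 0 2 0
  have e₄ := mid 1 0 1
  have e₅ := mid 1 1 2
  have e₆ := mid 1 2 0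
  simp only [d, lam_mid, F.vert] at e₁ e₂ e₃ e₄ e₅ e₆
  simp at e₁ e₂ e₃ e₄ e₅ e₆
  have p₀ : p 0 = 0 := by linarith
  have p₁ : p 1 = 0 := by linarith
  have p₂ : p 2 = 0 := by linarith
  have m₀ : m 0 = 0 := by linarith
  have m₁ : m 1 = 0 := by linarith
  have m₂ : m 2 = 0 := by linarith
  rw [hτ]
  funext x
  simp [hq, p₀, p₁, p₂, m₀, m₁, m₂]

end Frame

/-- the 21 listed fields form a basis of Σ(K): each belongs to Σ(K),
they are linearly independent, and they span Σ(K). -/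
theorem statement6 (v : Fin 3 → V2) (hv : AffineIndependent ℝ v)
    (lam : Fin 3 → V2 → ℝ) (g : Fin 3 → V2)
    (hlin : ∀ ℓ x, lam ℓ x = dot2 (g ℓ) x + lam ℓ 0)
    (hvert : ∀ ℓ m, lam ℓ (v m) = if ℓ = m then 1 else 0) :
    (∀ m, basis21 v lam g m ∈ SigmaSet v) ∧
    LinearIndependent ℝ (basis21 v lam g) ∧
    (∀ τ ∈ SigmaSet v, ∃ c : Fin 3 × Fin 7 → ℝ, τ = ∑ m, c m • basis21 v lam g m) := by
  obtain ⟨D, F⟩ := exists_frame hlin hvert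
  have inj : Function.Injective (Frame.dof v g ∘ₗ Fintype.linearCombination ℝ (basis21 v lam g)) := by
    rw [injective_iff_map_eq_zero]
    exact fun c hc => F.dof_basis21_injective hc
  refine ⟨F.basis21_mem, ?_, fun τ hτ => ?_⟩
  · rw [Fintype.linearIndependent_iff]
    intro c hc i
    exact congr_fun (F.dof_basis21_injective (c := c) (by rw [hc, map_zero])) i
  · obtain ⟨c, hc⟩ := LinearMap.injective_iff_surjective.1 inj (Frame.dof v g τ)
    refine ⟨c, sub_eq_zero.1 (F.eq_zero_of_dof ?_ ?_)⟩
    · exact (sigmaSubmodule v).sub_mem hτ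
        (Submodule.sum_mem _ fun m _ => Submodule.smul_mem _ _ (F.basis21_mem m))
    · rw [map_sub, ← hc]
      exact sub_self _
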